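/- Full spectrum of the Lindbladian with local dephasing (Proposition 5.2): Let G > 0 and let 𝓛 be the bounded operator on ℓ²(ℤ×ℤ) defined by (𝓛ψ)(x,y) = i·(ψ(x+1,y) + ψ(x−1,y) − ψ(x,y+1) − ψ(x,y−1)) − G·ψ(x,y) + G·(if x = y then ψ(x,x) else 0). (This is the vectorized Lindblad generator with Hamiltonian H = −(S + S*) and Lindblad operators L_k = |e_k⟩⟨e_k|, k ∈ ℤ, with coupling constant G.) Then σ(𝓛) = { −G + i·t : t ∈ ℝ, −4 ≤ t ≤ 4 } ∪ J, where J = { s ∈ ℝ : −G ≤ s ≤ 0 } if G ≤ 4, and J = { s ∈ ℝ : −G + √(G² − 16) ≤ s ≤ 0 } if G ≥ 4 (real intervals regarded as subsets of ℂ). -/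

import Mathlib

open Complex
open scoped ComplexOrder

/-- A perturbation `W + Q` of an invertible `W` with inverse `R` is invertible as soon as some `F`
solves the transition-operator equations `F = Q - Q R F = Q - F R Q`. -/
lemma isUnit_add_of_transition {A : Type*} [Ring A] {W R Q F : A} (hWR : W * R = 1)
    (hRW : R * W = 1) (h₁ : F + Q * R * F = Q) (h₂ : F + F * R * Q = Q) : IsUnit (W + Q) := by
  refine ⟨⟨W + Q, R - R * F * R, ?_, ?_⟩, rfl⟩
  · calc (W + Q) * (R - R * F * R)
        = W * R - W * R * F * R + Q * R - Q * R * F * R := by noncomm_ring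
      _ = 1 - (F + Q * R * F) * R + Q * R := by rw [hWR]; noncomm_ring
      _ = 1 := by rw [h₁]; noncomm_ring
  · calc (R - R * F * R) * (W + Q)
        = R * W - R * F * (R * W) + R * Q - R * F * R * Q := by noncomm_ring
      _ = 1 - R * (F + F * R * Q) + R * Q := by rw [hRW]; noncomm_ring
      _ = 1 := by rw [h₂]; noncomm_ring

/-- The principal square root of a number in the slit plane has positive real part. -/
lemma Complex.re_cpow_half_pos {z : ℂ} (hz : z ∈ slitPlane) : 0 < (z ^ (1 / 2 : ℂ)).re := by
  have hz0 : z ≠ 0 := slitPlane_ne_zero hz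
  rw [cpow_def_of_ne_zero hz0, exp_re]
  refine mul_pos (Real.exp_pos _) (Real.cos_pos_of_mem_Ioo ?_)
  have h1 := neg_pi_lt_arg z
  have h2 := (arg_le_pi z).lt_of_ne (mem_slitPlane_iff_arg.1 hz).1
  have : (log z * (1 / 2)).im = arg z / 2 := by
    rw [show (1 / 2 : ℂ) = ((1 / 2 : ℝ) : ℂ) by norm_num, im_mul_ofReal, log_im]; ring
  rw [this]
  constructor <;> linarith

lemma sq_add_mem_slitPlane {w : ℂ} (hw : 0 < w.re) {k : ℝ} (hk : 0 ≤ k) :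
    w ^ 2 + 4 * (k : ℂ) ∈ slitPlane := by
  rw [mem_slitPlane_iff]
  by_cases h : w.im = 0
  · left
    simp [sq, h]
    positivity
  · right
    simp [sq]
    intro h'
    have : w.re * w.im = 0 := by linarith
    simp [hw.ne', h] at this

/-- Of the roots `(w ± δ) / 2` of `ρ² - w ρ - k`, the one with the plus sign is the larger. -/
lemma norm_sub_lt_norm_add {w δ : ℂ} {k : ℝ} (hw : 0 < w.re) (hδ : 0 < δ.re)
    (h : δ ^ 2 = w ^ 2 + 4 * (k : ℂ)) : ‖δ - w‖ < ‖w + δ‖ := by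
  have him : δ.re * δ.im = w.re * w.im := by
    have := congrArg im h
    simp [sq] at this
    linarith
  have hpos : 0 ≤ δ.im * w.im := by
    have : 0 ≤ (δ.re * w.re) * (δ.im * w.im) := by
      have : (δ.re * w.re) * (δ.im * w.im) = (w.re * w.im) ^ 2 := by
        rw [show (δ.re * w.re) * (δ.im * w.im) = (δ.re * δ.im) * (w.re * w.im) by ring, him]; ring
      rw [this]; positivity
    exact nonneg_of_mul_nonneg_right this (by positivity)
  refine lt_of_pow_lt_pow_left₀ 2 (norm_nonneg _) ?_
  rw [Complex.sq_norm, Complex.sq_norm, normSq_apply, normSq_apply]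
  simp only [sub_re, sub_im, add_re, add_im]
  nlinarith [mul_pos hδ hw]

lemma compress_geometric {A : Type*} [NormedRing A] [HasSummableGeomSeries A] {P u : A}
    (hP : P * P = P) (hu : ‖u‖ < 1) (h : ∀ n, P * u ^ (n + 1) * P = 0) :
    P * (∑' n, u ^ n) * P = P := by
  have hs := summable_geometric_of_norm_lt_one hu
  rw [← hs.tsum_mul_left, ← (hs.mul_left P).tsum_mul_right, tsum_eq_single 0]
  · simp [hP]
  · intro n hn
    obtain ⟨m, rfl⟩ := Nat.exists_eq_succ_of_ne_zero hn
    exact h m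

/-- Functions of a self-adjoint `K` with spectrum in `[0, 4]` which factorize the symbol
`w - i (b + b*)` with `b b* = K`: `ρ` is the larger root of `ρ² - w ρ - K`, `p` its inverse, `s` the
inverse of the square root of `w² + 4 K`. -/
lemma exists_symbol_factorization {A : Type*} [CStarAlgebra A] {K : A} (hKsa : IsSelfAdjoint K)
    (hspec : ∀ z ∈ spectrum ℂ K, ∃ k : ℝ, 0 ≤ k ∧ k ≤ 4 ∧ z = k) {w : ℂ} (hw : 0 < w.re) {G : ℂ}
    (hG : ∀ k : ℝ, 0 ≤ k → k ≤ 4 → w ^ 2 + 4 * (k : ℂ) ≠ G ^ 2) :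
    ∃ ρ s p e : A, (∀ x, Commute K x → Commute s x) ∧ (∀ x, Commute K x → Commute p x) ∧
      (∀ x, Commute K x → Commute e x) ∧
      ρ * p = 1 ∧ p * ρ = 1 ∧ ρ - p * K = w • 1 ∧ s * (ρ + p * K) = 1 ∧
      e - G • (e * s) = G • 1 ∧ ‖p * K * star p‖ < 1 := by
  set δ : ℂ → ℂ := fun z ↦ (w ^ 2 + 4 * z) ^ (1 / 2 : ℂ) with hδ
  have hslit : ∀ z ∈ spectrum ℂ K, w ^ 2 + 4 * z ∈ slitPlane := by
    intro z hz
    obtain ⟨k, h0, -, rfl⟩ := hspec z hz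
    exact sq_add_mem_slitPlane hw h0
  have hδre : ∀ z ∈ spectrum ℂ K, 0 < (δ z).re := fun z hz ↦ re_cpow_half_pos (hslit z hz)
  have hδsq : ∀ z, δ z ^ 2 = w ^ 2 + 4 * z := by
    intro z
    simp only [hδ, one_div]
    exact cpow_nat_inv_pow _ two_ne_zero
  have hδ0 : ∀ z ∈ spectrum ℂ K, δ z ≠ 0 := by
    intro z hz h
    simpa [h] using hδre z hz
  have hρ0 : ∀ z ∈ spectrum ℂ K, w + δ z ≠ 0 := by
    intro z hz h
    have := congrArg re h
    have h2 := hδre z hz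
    simp only [add_re, zero_re] at this
    linarith
  have hδG : ∀ z ∈ spectrum ℂ K, δ z - G ≠ 0 := by
    intro z hz h
    obtain ⟨k, h0, h4, rfl⟩ := hspec z hz
    refine hG k h0 h4 ?_
    rw [← hδsq, sub_eq_zero.1 h]
  have cδ : ContinuousOn δ (spectrum ℂ K) :=
    ContinuousOn.cpow (by fun_prop) (by fun_prop) hslit
  have cρ : ContinuousOn (fun z ↦ (w + δ z) / 2) (spectrum ℂ K) := by fun_prop
  have cs : ContinuousOn (fun z ↦ (δ z)⁻¹) (spectrum ℂ K) := cδ.inv₀ hδ0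
  have cp : ContinuousOn (fun z ↦ 2 / (w + δ z)) (spectrum ℂ K) :=
    continuousOn_const.div (by fun_prop) hρ0
  have ce : ContinuousOn (fun z ↦ G * δ z / (δ z - G)) (spectrum ℂ K) :=
    ContinuousOn.div (by fun_prop) (by fun_prop) hδG
  have hKn : IsStarNormal K := hKsa.isStarNormal
  have comm : ∀ (f : ℂ → ℂ) (x : A), Commute K x → Commute (cfc f K) x :=
    fun f x hx ↦ hKsa.commute_cfc hx f
  have hmulK : cfc (fun z ↦ 2 / (w + δ z)) K * K = cfc (fun z ↦ 2 / (w + δ z) * z) K := by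
    rw [cfc_mul _ _ K cp (by fun_prop), cfc_id' ℂ K]
  refine ⟨cfc (fun z ↦ (w + δ z) / 2) K, cfc (fun z ↦ (δ z)⁻¹) K, cfc (fun z ↦ 2 / (w + δ z)) K,
    cfc (fun z ↦ G * δ z / (δ z - G)) K, comm _, comm _, comm _, ?_, ?_, ?_, ?_, ?_, ?_⟩
  · rw [← cfc_mul _ _ K cρ cp, ← cfc_one ℂ K]
    refine cfc_congr fun z hz ↦ ?_
    have := hρ0 z hz
    simp only [Pi.one_apply]
    field_simp
  · rw [← cfc_mul _ _ K cp cρ, ← cfc_one ℂ K]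
    refine cfc_congr fun z hz ↦ ?_
    have := hρ0 z hz
    simp only [Pi.one_apply]
    field_simp
  · rw [hmulK, ← cfc_sub _ _ K cρ (by fun_prop),
      ← Algebra.algebraMap_eq_smul_one, ← cfc_const w K]
    refine cfc_congr fun z hz ↦ ?_
    have := hρ0 z hz
    have h2 := hδsq z
    field_simp
    linear_combination h2
  · rw [hmulK, ← cfc_add K _ _ cρ (by fun_prop),
      ← cfc_mul _ _ K cs (by fun_prop), ← cfc_one ℂ K]
    refine cfc_congr fun z hz ↦ ?_
    have := hρ0 z hz
    have h1 := hδ0 z hz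
    have h2 := hδsq z
    simp only [Pi.one_apply]
    field_simp
    linear_combination -h2
  · rw [← cfc_mul _ _ K ce cs, ← cfc_smul _ _ K (by fun_prop), ← cfc_sub _ _ K ce (by fun_prop),
      ← Algebra.algebraMap_eq_smul_one, ← cfc_const G K]
    refine cfc_congr fun z hz ↦ ?_
    have := hδG z hz
    have h1 := hδ0 z hz
    simp only [smul_eq_mul]
    field_simp
  · rw [hmulK, ← cfc_star, ← cfc_mul _ _ K (by fun_prop) cp.star]
    refine norm_cfc_lt one_pos fun z hz ↦ ?_
    obtain ⟨k, h0, h4, rfl⟩ := hspec z hz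
    have h1 := norm_sub_lt_norm_add hw (hδre _ hz) (hδsq _)
    have h2 : (4 * k : ℂ) = (δ k - w) * (w + δ k) := by
      linear_combination -hδsq k
    have h3 := congrArg norm h2
    have h4 : 0 < ‖w + δ k‖ := norm_pos_iff.2 (hρ0 _ hz)
    simp only [norm_mul, norm_div, RCLike.star_def, RCLike.norm_conj, Complex.norm_ofNat,
      Complex.norm_real] at h3 ⊢
    field_simp
    rw [show (2 : ℝ) ^ 2 * ‖k‖ = 4 * ‖k‖ by ring, h3]
    nlinarith

/-- Let `b` be normal and `P` an idempotent which commutes with `b b*` and compresses all powers of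
`b` and `b*` to zero. Then `i (b + b*) - w + G P` is invertible when `Re w > 0` and `G²` avoids
`w² + [0, 16]`. -/
theorem isUnit_hopping_add_idempotent {A : Type*} [CStarAlgebra A] {b P : A} (hb : IsStarNormal b)
    (hb2 : ‖b‖ ≤ 2) (hP : P * P = P) (hPK : Commute (b * star b) P)
    (hPb : ∀ n, P * b ^ (n + 1) * P = 0) (hPb' : ∀ n, P * star b ^ (n + 1) * P = 0)
    {w : ℂ} (hw : 0 < w.re) {G : ℂ}
    (hG : ∀ k : ℝ, 0 ≤ k → k ≤ 4 → w ^ 2 + 4 * (k : ℂ) ≠ G ^ 2) :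
    IsUnit (I • (b + star b) - w • (1 : A) + G • P) := by
  set K := b * star b with hK
  have hKsa : IsSelfAdjoint K := .mul_star_self b
  have hbb : star b * b = K := hb.star_comm_self.eq
  have hKb : Commute K b := by
    rw [Commute, SemiconjBy, mul_assoc, hbb]
  have hKb' : Commute K (star b) := by
    rw [Commute, SemiconjBy, ← hbb, mul_assoc, ← hK, hbb]
  have hspec : ∀ z ∈ spectrum ℂ K, ∃ k : ℝ, 0 ≤ k ∧ k ≤ 4 ∧ z = k := by
    let _ := CStarAlgebra.spectralOrder A
    have _ := CStarAlgebra.spectralOrderedRing A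
    intro z hz
    have h0 := spectrum_nonneg_of_nonneg (𝕜 := ℂ) (mul_star_self_nonneg b) hz
    have h1 := IsometricContinuousFunctionalCalculus.norm_spectrum_le (𝕜 := ℂ) K hz
      (ha := hKsa.isStarNormal)
    rw [hK, CStarRing.norm_self_mul_star] at h1
    obtain ⟨hre, him⟩ := Complex.le_def.1 h0
    refine ⟨z.re, hre, ?_, ?_⟩
    · have := Complex.re_le_norm z
      nlinarith [norm_nonneg b]
    · apply Complex.ext <;> simp [← him]
  obtain ⟨ρ, s, p, e, cs, cp, ce, hρp, hpρ, hwid, hsid, heid, hpK⟩ :=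
    exists_symbol_factorization hKsa hspec hw hG
  have hpow : ∀ {c : A} (n : ℕ), Commute K c → P * c ^ (n + 1) * P = 0 →
      P * (I • (p * c)) ^ (n + 1) * P = 0 := by
    intro c n hc h
    rw [smul_pow, (cp c hc).mul_pow, mul_smul_comm, smul_mul_assoc, ← mul_assoc,
      ← ((cp P hPK).pow_left (n + 1)).eq, mul_assoc, mul_assoc, ← mul_assoc P, h, mul_zero,
      smul_zero]
  have hnorm : ∀ {c : A}, c * star c = K → ‖I • (p * c)‖ < 1 := by
    intro c hc
    rw [norm_smul, norm_I, one_mul]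
    refine lt_of_pow_lt_pow_left₀ 2 zero_le_one ?_
    rw [sq, ← CStarRing.norm_self_mul_star, star_mul, mul_assoc, ← mul_assoc c, hc, ← mul_assoc]
    simpa using hpK
  set u := I • (p * b) with hu
  set v := I • (p * star b) with hv
  have hun : ‖u‖ < 1 := hnorm hK.symm
  have hvn : ‖v‖ < 1 := hnorm (by rwa [star_star])
  set U := ∑' n, u ^ n
  set V := ∑' n, v ^ n
  have hU : (1 - u) * U = 1 := mul_neg_geom_series u hun
  have hV : (1 - v) * V = 1 := mul_neg_geom_series v hvn
  have hPU : P * U * P = P := compress_geometric hP hun fun n ↦ hpow n hKb (hPb n)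
  have hPV : P * V * P = P := compress_geometric hP hvn fun n ↦ hpow n hKb' (hPb' n)
  have huv : u * v = - (p * p * K) := by
    rw [hu, hv, smul_mul_smul_comm, I_mul_I, mul_assoc, ← mul_assoc b, ← (cp b hKb).eq, mul_assoc,
      ← hK, neg_one_smul, mul_assoc]
  have hvu : v * u = - (p * p * K) := by
    rw [hu, hv, smul_mul_smul_comm, I_mul_I, mul_assoc, ← mul_assoc (star b), ← (cp _ hKb').eq,
      mul_assoc, hbb, neg_one_smul, mul_assoc]
  set W := I • (b + star b) - w • (1 : A)
  have hW : W = -(ρ * ((1 - u) * (1 - v))) := by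
    have h1 : ρ * u = I • b := by rw [hu, mul_smul_comm, ← mul_assoc, hρp, one_mul]
    have h2 : ρ * v = I • star b := by rw [hv, mul_smul_comm, ← mul_assoc, hρp, one_mul]
    have h3 : ρ * (u * v) = -(p * K) := by
      rw [huv, mul_neg, mul_assoc p, ← mul_assoc ρ, hρp, one_mul]
    calc W = -ρ + I • b + I • star b + p * K := by
          simp only [W]; rw [← hwid, smul_add]; abel
      _ = -ρ + ρ * u + ρ * v - ρ * (u * v) := by rw [h1, h2, h3]; abel
      _ = _ := by noncomm_ring
  have hWu : IsUnit W := by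
    rw [hW, IsUnit.neg_iff]
    exact .mul ⟨⟨ρ, p, hρp, hpρ⟩, rfl⟩
      ((isUnit_one_sub_of_norm_lt_one hun).mul (isUnit_one_sub_of_norm_lt_one hvn))
  have huv1 : (1 - u) * (1 - v) * (U + V - 1) = 1 + p * p * K := by
    have : (1 - u) * (1 - v) = (1 - v) * (1 - u) := by
      have h : u * v = v * u := by rw [huv, hvu]
      rw [one_sub_mul, one_sub_mul, mul_one_sub, mul_one_sub, h]
      abel
    calc (1 - u) * (1 - v) * (U + V - 1)
        = (1 - u) * (1 - v) * U + (1 - u) * ((1 - v) * V) - (1 - u) * (1 - v) := by noncomm_ring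
      _ = (1 - v) * ((1 - u) * U) + (1 - u) * ((1 - v) * V) - (1 - u) * (1 - v) := by
        rw [this]; noncomm_ring
      _ = 1 - u * v := by rw [hU, hV]; noncomm_ring
      _ = _ := by rw [huv]; abel
  have hKu : Commute K W :=
    ((hKb.add_right hKb').smul_right I).sub_right ((Commute.one_right K).smul_right w)
  set R := -(s * (U + V - 1))
  have hWR : W * R = 1 := by
    calc W * R = W * s * -(U + V - 1) := by simp only [R]; noncomm_ring
      _ = s * (ρ * ((1 - u) * (1 - v) * (U + V - 1))) := by
        rw [← (cs W hKu).eq, hW]; noncomm_ring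
      _ = s * (ρ + ρ * p * p * K) := by rw [huv1]; noncomm_ring
      _ = 1 := by rw [hρp, one_mul, hsid]
  have hRW : R * W = 1 := by
    obtain ⟨W', hW'⟩ := hWu.exists_left_inv
    rwa [left_inv_eq_right_inv hW' hWR] at hW'
  have hPRP : P * R * P = -(s * P) := by
    calc P * R * P = - (P * s * (U + V - 1) * P) := by simp only [R]; noncomm_ring
      _ = - (s * (P * U * P + P * V * P - P * P)) := by
        rw [← (cs P hPK).eq]; noncomm_ring
      _ = _ := by rw [hPU, hPV, hP]; noncomm_ring
  have hes : e * s = s * e := (ce s (cs K (.refl K)).symm).eq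
  refine isUnit_add_of_transition (F := e * P) hWR hRW ?_ ?_
  · calc e * P + G • P * R * (e * P) = e * P + G • (P * R * (P * e)) := by
          rw [(ce P hPK).eq, smul_mul_assoc, smul_mul_assoc]
      _ = e * P + G • (P * R * P * e) := by noncomm_ring
      _ = e * P - G • (s * (P * e)) := by
        rw [hPRP, neg_mul, smul_neg, mul_assoc, sub_eq_add_neg]
      _ = (e - G • (e * s)) * P := by
        rw [← (ce P hPK).eq, hes, sub_mul, smul_mul_assoc, mul_assoc]
      _ = _ := by rw [heid, smul_mul_assoc, one_mul]
  · calc e * P + e * P * R * (G • P) = e * P + G • (e * (P * R * P)) := by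
          rw [mul_smul_comm]; noncomm_ring
      _ = (e - G • (e * s)) * P := by
        rw [hPRP, sub_mul, smul_mul_assoc, mul_neg, smul_neg, mul_assoc, sub_eq_add_neg]
      _ = _ := by rw [heid, smul_mul_assoc, one_mul]

/-- The numerical range of `i T + G P` lies in the rectangle `[0, G] + i [-4, 4]`. -/
lemma isUnit_of_notMem_rectangle {H : Type*} [NormedAddCommGroup H] [InnerProductSpace ℂ H]
    [CompleteSpace H] {T P : H →L[ℂ] H} (hT : IsSelfAdjoint T) (hT4 : ‖T‖ ≤ 4)
    (hP : IsStarProjection P) {G : ℝ} (hG : 0 < G) {w : ℂ}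
    (hw : w.re < 0 ∨ G < w.re ∨ 4 < |w.im|) :
    IsUnit (I • T - w • (1 : H →L[ℂ] H) + (G : ℂ) • P) := by
  obtain ⟨hre, him⟩ : (∀ x, (inner ℂ ((I • T - w • (1 : H →L[ℂ] H) + (G : ℂ) • P) x) x).re =
        G * ‖P x‖ ^ 2 - w.re * ‖x‖ ^ 2) ∧
      (∀ x, (inner ℂ ((I • T - w • (1 : H →L[ℂ] H) + (G : ℂ) • P) x) x).im =
        w.im * ‖x‖ ^ 2 - (inner ℂ (T x) x).re) := by
    have key : ∀ x, inner ℂ ((I • T - w • (1 : H →L[ℂ] H) + (G : ℂ) • P) x) x =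
        -I * (inner ℂ (T x) x).re - (starRingEnd ℂ) w * (‖x‖ : ℂ) ^ 2 + G * (‖P x‖ : ℂ) ^ 2 := by
      intro x
      have h1 : inner ℂ (P x) x = (‖P x‖ : ℂ) ^ 2 := by
        have hPP : P (P x) = P x := DFunLike.congr_fun hP.isIdempotentElem.eq x
        have hs : inner ℂ (P x) (P x) = inner ℂ (P (P x)) x :=
          (hP.isSelfAdjoint.isSymmetric (P x) x).symm
        rw [← hPP, ← hs, inner_self_eq_norm_sq_to_K, hPP]
        rfl
      have h2 : ((inner ℂ (T x) x).re : ℂ) = inner ℂ (T x) x :=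
        hT.isSymmetric.coe_re_inner_apply_self x
      simp only [add_apply, sub_apply, smul_apply, one_apply_eq_self, inner_add_left,
        inner_sub_left, inner_smul_left, h1, h2, conj_I, conj_ofReal,
        inner_self_eq_norm_sq_to_K]
      rfl
    constructor <;> intro x <;> rw [key] <;> simp [← ofReal_pow] <;> ring
  have hPx : ∀ x, ‖P x‖ ^ 2 ≤ ‖x‖ ^ 2 := by
    intro x
    have := P.le_of_opNorm_le hP.norm_le x
    gcongr
    simpa using this
  have hTx : ∀ x, |(inner ℂ (T x) x).re| ≤ 4 * ‖x‖ ^ 2 := by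
    intro x
    calc |(inner ℂ (T x) x).re| ≤ ‖inner ℂ (T x) x‖ := abs_re_le_norm _
      _ ≤ ‖T x‖ * ‖x‖ := norm_inner_le_norm _ _
      _ ≤ (4 * ‖x‖) * ‖x‖ := by gcongr; exact T.le_of_opNorm_le hT4 x
      _ = _ := by ring
  have hunit : ∀ {c : ℝ}, 0 < c → (∀ x, ‖x‖ ^ 2 * c ≤
      ‖inner ℂ ((I • T - w • (1 : H →L[ℂ] H) + (G : ℂ) • P) x) x‖) →
      IsUnit (I • T - w • (1 : H →L[ℂ] H) + (G : ℂ) • P) := by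
    intro c hc h
    lift c to NNReal using hc.le
    exact ContinuousLinearMap.isUnit_of_forall_le_norm_inner_map _ (NNReal.coe_pos.1 hc) h
  rcases hw with hw | hw | hw
  · refine hunit (neg_pos.2 hw) fun x ↦ le_trans ?_ (abs_re_le_norm _)
    rw [hre]
    refine le_trans ?_ (le_abs_self _)
    nlinarith [sq_nonneg ‖P x‖]
  · refine hunit (sub_pos.2 hw) fun x ↦ le_trans ?_ (abs_re_le_norm _)
    rw [hre]
    refine le_trans ?_ (neg_le_abs _)
    nlinarith [hPx x]
  · refine hunit (sub_pos.2 hw) fun x ↦ le_trans ?_ (abs_im_le_norm _)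
    rw [him]
    have h := abs_sub_abs_le_abs_sub (w.im * ‖x‖ ^ 2) (inner ℂ (T x) x).re
    rw [abs_mul, abs_of_nonneg (sq_nonneg ‖x‖)] at h
    linarith [hTx x]

section Shifts

/-- Precomposition with a permutation of the index set, as a unitary operator on `ℓ²`. -/
noncomputable def lpReindex {ι : Type*} (e : ι ≃ ι) :
    lp (fun _ : ι => ℂ) 2 ≃ₗᵢ[ℂ] lp (fun _ : ι => ℂ) 2 where
  toFun f := ⟨fun i ↦ f (e i), memℓp_gen (e.summable_iff.2 ((lp.memℓp f).summable (by norm_num)))⟩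
  invFun f := ⟨fun i ↦ f (e.symm i),
    memℓp_gen (e.symm.summable_iff.2 ((lp.memℓp f).summable (by norm_num)))⟩
  map_add' _ _ := rfl
  map_smul' _ _ := rfl
  left_inv f := by ext i; simp
  right_inv f := by ext i; simp
  norm_map' f := by
    rw [lp.norm_eq_tsum_rpow (by norm_num), lp.norm_eq_tsum_rpow (by norm_num)]
    congr 1
    exact e.tsum_eq (fun i ↦ ‖f i‖ ^ (2 : ENNReal).toReal)

/-- Hilbert–Schmidt operators on `ℓ²(ℤ)`, as matrices. -/
abbrev HSMatrix : Type := lp (fun _ : ℤ × ℤ => ℂ) 2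

/-- The shift `ψ ↦ ψ (· + 1, ·)` of the first coordinate. -/
noncomputable def shiftFst : HSMatrix ≃ₗᵢ[ℂ] HSMatrix :=
  lpReindex ((Equiv.addRight (1 : ℤ)).prodCongr (Equiv.refl ℤ))

/-- The shift `ψ ↦ ψ (·, · + 1)` of the second coordinate. -/
noncomputable def shiftSnd : HSMatrix ≃ₗᵢ[ℂ] HSMatrix :=
  lpReindex ((Equiv.refl ℤ).prodCongr (Equiv.addRight (1 : ℤ)))

lemma shiftFst_apply (ψ : HSMatrix) (x y : ℤ) : shiftFst ψ (x, y) = ψ (x + 1, y) := rfl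
lemma shiftSnd_apply (ψ : HSMatrix) (x y : ℤ) : shiftSnd ψ (x, y) = ψ (x, y + 1) := rfl
lemma shiftFst_symm_apply (ψ : HSMatrix) (x y : ℤ) : shiftFst.symm ψ (x, y) = ψ (x - 1, y) := rfl
lemma shiftSnd_symm_apply (ψ : HSMatrix) (x y : ℤ) : shiftSnd.symm ψ (x, y) = ψ (x, y - 1) := rfl

/-- The part of the commutator with the hopping Hamiltonian which lowers `x - y` by one. -/
noncomputable def hop : HSMatrix →L[ℂ] HSMatrix :=
  (shiftFst : HSMatrix →L[ℂ] HSMatrix) - (shiftSnd.symm : HSMatrix →L[ℂ] HSMatrix)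

lemma hop_apply (ψ : HSMatrix) (x y : ℤ) : hop ψ (x, y) = ψ (x + 1, y) - ψ (x, y - 1) := rfl

lemma star_hop_apply (ψ : HSMatrix) (x y : ℤ) :
    star hop ψ (x, y) = ψ (x - 1, y) - ψ (x, y + 1) := by
  have : star hop =
      (shiftFst.symm : HSMatrix →L[ℂ] HSMatrix) - (shiftSnd : HSMatrix →L[ℂ] HSMatrix) := by
    rw [hop, star_sub, ContinuousLinearMap.star_eq_adjoint, ContinuousLinearMap.star_eq_adjoint,
      LinearIsometryEquiv.adjoint_eq_symm, LinearIsometryEquiv.adjoint_eq_symm,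
      LinearIsometryEquiv.symm_symm]
  rw [this]
  rfl

lemma norm_hop_le : ‖hop‖ ≤ 2 := by
  refine (norm_sub_le _ _).trans ?_
  have h1 := shiftFst.toLinearIsometry.norm_toContinuousLinearMap_le
  have h2 := shiftSnd.symm.toLinearIsometry.norm_toContinuousLinearMap_le
  exact (add_le_add h1 h2).trans (by norm_num)

lemma hop_mul_star_hop_apply (ψ : HSMatrix) (x y : ℤ) :
    (hop * star hop) ψ (x, y) = 2 * ψ (x, y) - ψ (x + 1, y + 1) - ψ (x - 1, y - 1) := by
  simp only [mul_apply_eq_comp, hop_apply, star_hop_apply]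
  ring_nf

lemma isStarNormal_hop : IsStarNormal hop := by
  refine ⟨?_⟩
  rw [Commute, SemiconjBy]
  ext ψ ⟨x, y⟩
  rw [hop_mul_star_hop_apply]
  simp only [mul_apply_eq_comp, hop_apply, star_hop_apply]
  ring_nf

lemma pow_hop_apply_eq_zero {ψ : HSMatrix} (hψ : ∀ x y, x ≠ y → ψ (x, y) = 0) (n : ℕ) :
    ∀ x y : ℤ, y - x ≠ n → (hop ^ n) ψ (x, y) = 0 := by
  induction n with
  | zero => exact fun x y h ↦ hψ x y fun h' ↦ h (by simp [h'])
  | succ n ih =>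
    intro x y h
    push_cast at h
    rw [pow_succ', mul_apply_eq_comp, hop_apply, ih _ _ (by omega),
      ih _ _ (by omega), sub_zero]

lemma pow_star_hop_apply_eq_zero {ψ : HSMatrix} (hψ : ∀ x y, x ≠ y → ψ (x, y) = 0) (n : ℕ) :
    ∀ x y : ℤ, x - y ≠ n → (star hop ^ n) ψ (x, y) = 0 := by
  induction n with
  | zero => exact fun x y h ↦ hψ x y fun h' ↦ h (by simp [h'])
  | succ n ih =>
    intro x y h
    push_cast at h
    rw [pow_succ', mul_apply_eq_comp, star_hop_apply, ih _ _ (by omega),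
      ih _ _ (by omega), sub_zero]

variable {P : HSMatrix →L[ℂ] HSMatrix}

lemma isStarProjection_of_diagonal (hP : ∀ ψ x y, P ψ (x, y) = if x = y then ψ (x, y) else 0) :
    IsStarProjection P := by
  refine ⟨?_, ?_⟩
  · ext ψ ⟨x, y⟩
    simp +contextual [hP]
  · rw [ContinuousLinearMap.isSelfAdjoint_iff_isSymmetric]
    intro φ ψ
    change inner ℂ (P φ) ψ = inner ℂ φ (P ψ)
    rw [lp.inner_eq_tsum, lp.inner_eq_tsum]
    refine tsum_congr fun ⟨x, y⟩ ↦ ?_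
    rw [hP, hP]
    split_ifs <;> simp

/-- The operator `i (b + b*) - w + G P` is invertible away from the claimed spectrum. -/
lemma isUnit_hop_add_diagonal (hP : ∀ ψ x y, P ψ (x, y) = if x = y then ψ (x, y) else 0)
    {G : ℝ} (hG : 0 < G) {w : ℂ} (hw : w.re ≠ 0 ∨ 4 < |w.im|)
    (hw' : ∀ v : ℝ, 0 < v → v ≤ G → G ^ 2 - 16 ≤ v ^ 2 → w ≠ v) :
    IsUnit (I • (hop + star hop) - w • (1 : HSMatrix →L[ℂ] HSMatrix) + (G : ℂ) • P) := by
  have hPproj := isStarProjection_of_diagonal hP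
  by_cases hrect : w.re < 0 ∨ G < w.re ∨ 4 < |w.im|
  · refine isUnit_of_notMem_rectangle (.add_star_self hop) ?_ hPproj hG hrect
    have := norm_add_le hop (star hop)
    rw [ContinuousLinearMap.star_eq_adjoint, LinearIsometryEquiv.norm_map] at this
    rw [ContinuousLinearMap.star_eq_adjoint]
    linarith [norm_hop_le]
  push Not at hrect
  obtain ⟨h0, hwG, h4⟩ := hrect
  have hre : 0 < w.re := h0.lt_of_ne' (hw.resolve_right h4.not_gt)
  have hdiag : ∀ ψ x y, x ≠ y → P ψ (x, y) = 0 := fun ψ x y h ↦ by rw [hP, if_neg h]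
  refine isUnit_hopping_add_idempotent isStarNormal_hop norm_hop_le hPproj.isIdempotentElem ?_ ?_ ?_
    hre ?_
  · rw [Commute, SemiconjBy]
    ext ψ ⟨x, y⟩
    simp only [mul_apply_eq_comp]
    rw [← mul_apply_eq_comp hop, ← mul_apply_eq_comp hop]
    simp only [hop_mul_star_hop_apply, hP, add_left_inj, sub_left_inj]
    split_ifs <;> simp
  · intro n
    ext ψ ⟨x, y⟩
    simp only [mul_apply_eq_comp, hP]
    split_ifs with h
    · exact pow_hop_apply_eq_zero (hdiag ψ) (n + 1) x y (by push_cast; omega)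
    · rfl
  · intro n
    ext ψ ⟨x, y⟩
    simp only [mul_apply_eq_comp, hP]
    split_ifs with h
    · exact pow_star_hop_apply_eq_zero (hdiag ψ) (n + 1) x y (by push_cast; omega)
    · rfl
  · intro k hk0 hk4 h
    have him := congrArg im h
    have hre2 := congrArg re h
    simp [sq] at him hre2
    have hwim : w.im = 0 := by
      have : w.re * w.im = 0 := by linarith
      exact (mul_eq_zero.1 this).resolve_left hre.ne'
    rw [hwim] at hre2
    exact hw' w.re hre hwG (by nlinarith) (Complex.ext rfl (by simpa using hwim))

end Shifts

section GeneralizedEigenfunctions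

lemma abs_pow_sub_pow_le_of_adjacent {q : ℝ} (h0 : 0 < q) (h1 : q < 1) {m n : ℕ} (hmn : m ≤ n + 1)
    (hnm : n ≤ m + 1) : |q ^ m - q ^ n| ≤ (q⁻¹ - 1) * q ^ n := by
  have hq : q * q⁻¹ = 1 := mul_inv_cancel₀ h0.ne'
  have hq1 : 1 < q⁻¹ := (one_lt_inv₀ h0).2 h1
  obtain rfl | rfl | rfl : m = n ∨ m = n + 1 ∨ n = m + 1 := by omega
  · rw [sub_self, abs_zero]
    exact mul_nonneg (by linarith) (by positivity)
  · rw [abs_sub_comm, abs_of_nonneg (sub_nonneg.2 (pow_le_pow_of_le_one h0.le h1.le n.le_succ)),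
      pow_succ]
    have : 0 < q ^ n := by positivity
    nlinarith [mul_nonneg (sub_nonneg.2 h1.le) (sub_nonneg.2 hq1.le)]
  · rw [abs_of_nonneg (sub_nonneg.2 (pow_le_pow_of_le_one h0.le h1.le m.le_succ)), pow_succ,
      sub_mul, mul_comm (q ^ m), ← mul_assoc, mul_comm q⁻¹, hq]
    linarith

lemma summable_pow_natAbs {q : ℝ} (h0 : 0 ≤ q) (h1 : q < 1) :
    Summable fun n : ℤ ↦ q ^ n.natAbs := by
  have h := summable_geometric_of_lt_one h0 h1
  exact .of_nat_of_neg (by simpa using h) (by simpa using h)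

/-- Bounded functions become square summable after an exponential cutoff. -/
lemma memℓp_cutoff {q : ℝ} (h0 : 0 < q) (h1 : q < 1) {Ψ : ℤ × ℤ → ℂ} {C : ℝ}
    (hC : ∀ p, ‖Ψ p‖ ≤ C) :
    Memℓp (fun p : ℤ × ℤ ↦ (q : ℂ) ^ (p.1.natAbs + p.2.natAbs) * Ψ p) 2 := by
  have hq2 : q ^ 2 < 1 := by nlinarith
  have hs := (summable_pow_natAbs (sq_nonneg q) hq2).mul_of_nonneg
    (summable_pow_natAbs (sq_nonneg q) hq2) (fun _ ↦ by positivity) (fun _ ↦ by positivity)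
  refine memℓp_gen ((hs.mul_left (C ^ 2)).of_nonneg_of_le (fun p ↦ by positivity) fun p ↦ ?_)
  have hb : ‖Ψ p‖ ^ 2 ≤ C ^ 2 := by
    gcongr
    exact hC p
  simp only [ENNReal.toReal_ofNat, Real.rpow_ofNat, norm_mul, norm_pow, norm_real,
    Real.norm_eq_abs, abs_of_pos h0]
  rw [mul_pow, ← pow_add, ← pow_mul, ← pow_mul, mul_comm, mul_comm _ 2]
  gcongr

/-- A bounded generalized eigenfunction puts its eigenvalue into the spectrum. -/
lemma mem_spectrum_of_bounded_eigenfunction {G : ℂ} {L : HSMatrix →L[ℂ] HSMatrix}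
    (hL : ∀ (ψ : HSMatrix) (x y : ℤ),
      L ψ (x, y) = I * (ψ (x + 1, y) + ψ (x - 1, y) - ψ (x, y + 1) - ψ (x, y - 1))
        - G * ψ (x, y) + G * (if x = y then ψ (x, x) else 0))
    {z : ℂ} {Ψ : ℤ × ℤ → ℂ} {C : ℝ} (hC : ∀ p, ‖Ψ p‖ ≤ C) {p₀ : ℤ × ℤ} (hp₀ : Ψ p₀ ≠ 0)
    (hΨ : ∀ x y : ℤ, I * (Ψ (x + 1, y) + Ψ (x - 1, y) - Ψ (x, y + 1) - Ψ (x, y - 1))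
        - G * Ψ (x, y) + G * (if x = y then Ψ (x, x) else 0) = z * Ψ (x, y)) :
    z ∈ spectrum ℂ L := by
  intro hunit
  obtain ⟨S, hS⟩ := hunit.exists_left_inv
  set M := 4 * ‖S‖ + 1 with hM
  have hMpos : 0 < M := by positivity
  set q := M / (M + 1) with hq
  have h0 : 0 < q := by positivity
  have h1 : q < 1 := (div_lt_one (by positivity)).2 (by linarith)
  have hqinv : q⁻¹ - 1 = 1 / M := by rw [hq]; field_simp; ring
  let ψ : HSMatrix := ⟨_, memℓp_cutoff h0 h1 hC⟩
  have hψ : ∀ x y, ψ (x, y) = (q : ℂ) ^ (x.natAbs + y.natAbs) * Ψ (x, y) := fun _ _ ↦ rfl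
  let η : HSMatrix := ⟨fun p ↦ (‖ψ p‖ : ℂ), (lp.memℓp ψ).mono' fun p ↦ by simp⟩
  have hη : ∀ p, η p = (‖ψ p‖ : ℂ) := fun _ ↦ rfl
  have hηnorm : ‖η‖ ≤ ‖ψ‖ := lp.norm_mono two_ne_zero fun p ↦ by simp [hη]
  set g : HSMatrix := shiftFst η + shiftFst.symm η + shiftSnd η + shiftSnd.symm η
  have hg : ‖g‖ ≤ 4 * ‖ψ‖ := by
    have h := norm_add₄_le (a := shiftFst η) (b := shiftFst.symm η) (c := shiftSnd η)
      (d := shiftSnd.symm η)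
    simp only [LinearIsometryEquiv.norm_map] at h
    linarith
  have hbound : ‖(algebraMap ℂ _ z - L) ψ‖ ≤ ‖((1 / M : ℝ) : ℂ) • g‖ := by
    refine lp.norm_mono two_ne_zero fun ⟨x, y⟩ ↦ ?_
    have hcut : ∀ x' y' : ℤ, x'.natAbs + y'.natAbs ≤ x.natAbs + y.natAbs + 1 →
        x.natAbs + y.natAbs ≤ x'.natAbs + y'.natAbs + 1 →
        ‖((q : ℂ) ^ (x.natAbs + y.natAbs) - (q : ℂ) ^ (x'.natAbs + y'.natAbs)) * Ψ (x', y')‖ ≤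
          1 / M * ‖ψ (x', y')‖ := by
      intro x' y' h h'
      rw [hψ, norm_mul, norm_mul, ← mul_assoc, ← hqinv, ← ofReal_pow, ← ofReal_pow, ← ofReal_sub,
        norm_real, norm_real, Real.norm_eq_abs, Real.norm_eq_abs, abs_of_pos (pow_pos h0 _)]
      gcongr
      exact abs_pow_sub_pow_le_of_adjacent h0 h1 h' h
    have e1 := hcut (x + 1) y (by omega) (by omega)
    have e2 := hcut (x - 1) y (by omega) (by omega)
    have e3 := hcut x (y + 1) (by omega) (by omega)
    have e4 := hcut x (y - 1) (by omega) (by omega)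
    have hLHS : ((algebraMap ℂ (HSMatrix →L[ℂ] HSMatrix) z - L) ψ) (x, y) =
        I * (((q : ℂ) ^ (x.natAbs + y.natAbs) - (q : ℂ) ^ ((x + 1).natAbs + y.natAbs))
            * Ψ (x + 1, y)
          + ((q : ℂ) ^ (x.natAbs + y.natAbs) - (q : ℂ) ^ ((x - 1).natAbs + y.natAbs))
            * Ψ (x - 1, y)
          - ((q : ℂ) ^ (x.natAbs + y.natAbs) - (q : ℂ) ^ (x.natAbs + (y + 1).natAbs))
            * Ψ (x, y + 1)
          - ((q : ℂ) ^ (x.natAbs + y.natAbs) - (q : ℂ) ^ (x.natAbs + (y - 1).natAbs))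
            * Ψ (x, y - 1)) := by
      have : ((algebraMap ℂ (HSMatrix →L[ℂ] HSMatrix) z - L) ψ) (x, y) =
          z * ψ (x, y) - L ψ (x, y) := rfl
      rw [this, hL]
      simp only [hψ]
      have := hΨ x y
      split_ifs at this ⊢ with hxy
      · subst hxy
        linear_combination -(q : ℂ) ^ (x.natAbs + x.natAbs) * this
      · linear_combination -(q : ℂ) ^ (x.natAbs + y.natAbs) * this
    have hRHS : ‖(((1 / M : ℝ) : ℂ) • g) (x, y)‖ = 1 / M * (‖ψ (x + 1, y)‖ + ‖ψ (x - 1, y)‖ +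
        ‖ψ (x, y + 1)‖ + ‖ψ (x, y - 1)‖) := by
      have : (((1 / M : ℝ) : ℂ) • g) (x, y) = ((1 / M * (‖ψ (x + 1, y)‖ + ‖ψ (x - 1, y)‖ +
        ‖ψ (x, y + 1)‖ + ‖ψ (x, y - 1)‖) : ℝ) : ℂ) := by
        push_cast
        rfl
      rw [this, norm_real, Real.norm_of_nonneg (by positivity)]
    rw [hLHS, hRHS, norm_mul, norm_I, one_mul]
    refine (norm_sub_le _ _).trans ?_
    refine (add_le_add_left ((norm_sub_le _ _).trans (add_le_add_left (norm_add_le _ _) _)) _).trans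
      ?_
    linarith
  have hψ0 : 0 < ‖ψ‖ := by
    rw [norm_pos_iff]
    intro h
    have : ψ p₀ = 0 := by rw [h]; rfl
    rw [show p₀ = (p₀.1, p₀.2) from rfl, hψ] at this
    exact mul_ne_zero (pow_ne_zero _ (by exact_mod_cast h0.ne')) hp₀ this
  have hfin : ‖ψ‖ ≤ ‖S‖ * (1 / M * (4 * ‖ψ‖)) := by
    calc ‖ψ‖ = ‖S ((algebraMap ℂ _ z - L) ψ)‖ := by
          rw [← mul_apply_eq_comp, hS, one_apply_eq_self]
      _ ≤ ‖S‖ * ‖(algebraMap ℂ _ z - L) ψ‖ := S.le_opNorm _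
      _ ≤ ‖S‖ * ‖((1 / M : ℝ) : ℂ) • g‖ := by gcongr
      _ = ‖S‖ * (1 / M * ‖g‖) := by
        rw [norm_smul, norm_real, Real.norm_of_nonneg (by positivity)]
      _ ≤ _ := by gcongr
  have : ‖S‖ * (1 / M * (4 * ‖ψ‖)) = 4 * ‖S‖ / M * ‖ψ‖ := by ring
  rw [this] at hfin
  have : 4 * ‖S‖ / M < 1 := (div_lt_one hMpos).2 (by linarith)
  nlinarith

variable {G : ℝ} {L : HSMatrix →L[ℂ] HSMatrix}

/-- The standing waves `(-1)^y sin (θ (x - y))` vanish on the diagonal and fill `-G + i [-4, 4]`. -/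
lemma line_subset_spectrum (hL : ∀ (ψ : HSMatrix) (x y : ℤ),
      L ψ (x, y) = I * (ψ (x + 1, y) + ψ (x - 1, y) - ψ (x, y + 1) - ψ (x, y - 1))
        - (G : ℂ) * ψ (x, y) + (G : ℂ) * (if x = y then ψ (x, x) else 0))
    {t : ℝ} (ht : t ∈ Set.Icc (-4) 4) : -(G : ℂ) + I * (t : ℂ) ∈ spectrum ℂ L := by
  have hclosed : IsClosed {t : ℝ | -(G : ℂ) + I * (t : ℂ) ∈ spectrum ℂ L} :=
    (spectrum.isClosed L).preimage (f := fun t : ℝ ↦ -(G : ℂ) + I * (t : ℂ)) (by fun_prop)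
  rw [← closure_Ioo (by norm_num)] at ht
  refine closure_minimal (fun t ht ↦ ?_) hclosed ht
  obtain ⟨h1, h2⟩ := ht
  set θ := Real.arccos (t / 4)
  have hcos : Real.cos θ = t / 4 := Real.cos_arccos (by linarith) (by linarith)
  have hsin : Real.sin θ ≠ 0 :=
    (Real.sin_pos_of_pos_of_lt_pi (Real.arccos_pos.2 (by linarith))
      (lt_of_le_of_ne (Real.arccos_le_pi _) fun h ↦ by
        rw [Real.arccos_eq_pi] at h; linarith)).ne'
  refine mem_spectrum_of_bounded_eigenfunction hL (C := 1) (p₀ := (1, 0))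
    (Ψ := fun p ↦ (-1 : ℂ) ^ p.2 * (Real.sin (θ * (p.1 - p.2)) : ℂ)) (fun p ↦ ?_) ?_ fun x y ↦ ?_
  · rw [norm_mul, norm_zpow, norm_neg, norm_one, one_zpow, one_mul, norm_real]
    exact Real.abs_sin_le_one _
  · simpa [-ofReal_sin] using hsin
  · have hne : (-1 : ℂ) ≠ 0 := by norm_num
    have hp : Real.sin (θ * (x - y) + θ) + Real.sin (θ * (x - y) - θ) =
        t / 2 * Real.sin (θ * (x - y)) := by
      rw [Real.sin_add, Real.sin_sub, hcos]; ring
    have hpC := congrArg (fun r : ℝ ↦ (r : ℂ)) hp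
    simp only [ofReal_add, ofReal_mul, ofReal_div, ofReal_ofNat] at hpC
    have ha : θ * (((x + 1 : ℤ) : ℝ) - y) = θ * (x - y) + θ := by push_cast; ring
    have hb : θ * (((x - 1 : ℤ) : ℝ) - y) = θ * (x - y) - θ := by push_cast; ring
    have hc : θ * ((x : ℝ) - (y + 1 : ℤ)) = θ * (x - y) - θ := by push_cast; ring
    have hd : θ * ((x : ℝ) - (y - 1 : ℤ)) = θ * (x - y) + θ := by push_cast; ring
    simp only [ha, hb, hc, hd, zpow_add_one₀ hne, zpow_sub_one₀ hne, sub_self, mul_zero,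
      Real.sin_zero, ofReal_zero, ite_self]
    have hinv : ((-1 : ℂ))⁻¹ = -1 := by norm_num
    rw [hinv]
    linear_combination 2 * I * (-1 : ℂ) ^ y * hpC

/-- Waves along the diagonal, decaying like `r ^ |x - y|` away from it. -/
lemma bound_state_mem_spectrum (hL : ∀ (ψ : HSMatrix) (x y : ℤ),
      L ψ (x, y) = I * (ψ (x + 1, y) + ψ (x - 1, y) - ψ (x, y + 1) - ψ (x, y - 1))
        - (G : ℂ) * ψ (x, y) + (G : ℂ) * (if x = y then ψ (x, x) else 0))
    {w : ℝ} (hw0 : 0 < w) (hwG : w < G) (hw : G ^ 2 - 16 ≤ w ^ 2) :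
    -(G : ℂ) + (w : ℂ) ∈ spectrum ℂ L := by
  have hpos : 0 < G ^ 2 - w ^ 2 := by nlinarith
  set c := √(G ^ 2 - w ^ 2) / 4 with hc
  have hc0 : 0 < c := by positivity
  have hcsq : 16 * c ^ 2 = G ^ 2 - w ^ 2 := by
    rw [hc, div_pow, Real.sq_sqrt hpos.le]; ring
  have hc1 : c ≤ 1 := by nlinarith
  set r := (G - w) / (4 * c) with hr
  have hr0 : 0 < r := div_pos (by linarith) (by positivity)
  have hrc : 4 * r * c = G - w := by rw [hr]; field_simp
  have hrc' : 4 * r⁻¹ * c = G + w := by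
    rw [hr, inv_div]
    have : G - w ≠ 0 := by linarith
    field_simp
    linear_combination hcsq
  have hr1 : r ≤ 1 := by
    rw [hr, div_le_one (by positivity)]
    nlinarith
  set κ := Real.arcsin c
  have hsin : Real.sin κ = c := Real.sin_arcsin (by linarith) hc1
  set E := cexp (κ * I)
  have hE0 : E ≠ 0 := exp_ne_zero _
  have hE : E - E⁻¹ = 2 * I * c := by
    have h1 : E⁻¹ = cexp (-κ * I) := by rw [← exp_neg]; ring_nf
    have h2 : Complex.sin κ = c := by rw [← ofReal_sin, hsin]
    rw [h1, ← h2, Complex.sin]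
    linear_combination (E - cexp (-κ * I)) * I_sq
  have hEnorm : ‖E‖ = 1 := norm_exp_ofReal_mul_I κ
  have hrC0 : (r : ℂ) ≠ 0 := by exact_mod_cast hr0.ne'
  have hrcC : 4 * (r : ℂ) * c = G - w := by exact_mod_cast hrc
  have hrcC' : 4 * (r : ℂ)⁻¹ * c = G + w := by exact_mod_cast hrc'
  let g : ℤ → ℂ := fun n ↦ if 0 ≤ n then (r : ℂ) ^ n else (-(r : ℂ)) ^ (-n)
  have hgpos : ∀ n, 0 ≤ n → g n = (r : ℂ) ^ n := fun n hn ↦ if_pos hn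
  have hgneg : ∀ n, n ≤ 0 → g n = (-(r : ℂ)) ^ (-n) := by
    intro n hn
    rcases hn.lt_or_eq with h | rfl
    · exact if_neg h.not_ge
    · simp [g]
  have hgnorm : ∀ n, ‖g n‖ ≤ 1 := by
    intro n
    rcases le_total 0 n with h | h
    · rw [hgpos n h, norm_zpow, norm_real, Real.norm_of_nonneg hr0.le]
      lift n to ℕ using h
      exact_mod_cast pow_le_one₀ hr0.le hr1
    · rw [hgneg n h, norm_zpow, norm_neg, norm_real, Real.norm_of_nonneg hr0.le]
      obtain ⟨m, hm⟩ := Int.eq_ofNat_of_zero_le (neg_nonneg.2 h)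
      rw [hm]
      exact_mod_cast pow_le_one₀ hr0.le hr1
  have hg0 : g 0 = 1 := by simp [g]
  have hrec : ∀ n, 2 * I * c * I * (g (n + 1) - g (n - 1)) + (if n = 0 then (G : ℂ) else 0) * g n =
      w * g n := by
    intro n
    rcases lt_trichotomy n 0 with h | rfl | h
    · rw [hgneg n h.le, hgneg (n + 1) (by omega), hgneg (n - 1) (by omega), if_neg h.ne,
        show -(n + 1) = -n - 1 by ring, show -(n - 1) = -n + 1 by ring,
        zpow_add_one₀ (neg_ne_zero.2 hrC0), zpow_sub_one₀ (neg_ne_zero.2 hrC0), inv_neg]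
      linear_combination (-(r : ℂ)) ^ (-n) * ((1 / 2) * (hrcC' - hrcC)
        + 2 * c * (-(r : ℂ)⁻¹ + r) * I_sq)
    · rw [hgpos (0 + 1) (by norm_num), hgneg (0 - 1) (by norm_num), hg0, if_pos rfl]
      simp only [zero_add, zero_sub, neg_neg, zpow_one]
      linear_combination 4 * c * r * I_sq - hrcC
    · rw [hgpos n h.le, hgpos (n + 1) (by omega), hgpos (n - 1) (by omega), if_neg h.ne',
        zpow_add_one₀ hrC0, zpow_sub_one₀ hrC0]
      linear_combination (r : ℂ) ^ n * ((1 / 2) * (hrcC' - hrcC)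
        + 2 * c * (r - (r : ℂ)⁻¹) * I_sq)
  refine mem_spectrum_of_bounded_eigenfunction hL (C := 1) (p₀ := (0, 0))
    (Ψ := fun p ↦ E ^ p.1 * E ^ p.2 * g (p.1 - p.2)) (fun p ↦ ?_) ?_ fun x y ↦ ?_
  · simpa [norm_mul, norm_zpow, hEnorm] using hgnorm (p.1 - p.2)
  · simp [hg0]
  · have h := hrec (x - y)
    have hite : (if x = y then E ^ x * E ^ x * g (x - x) else 0) =
        E ^ x * E ^ y * ((if x - y = 0 then (1 : ℂ) else 0) * g (x - y)) := by
      by_cases hxy : x = y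
      · subst hxy; simp
      · simp [hxy, sub_eq_zero]
    have hite' : (if x - y = 0 then (G : ℂ) else 0) = G * (if x - y = 0 then (1 : ℂ) else 0) := by
      simp
    rw [hite'] at h
    simp only [hite, zpow_add_one₀ hE0, zpow_sub_one₀ hE0, show x + 1 - y = x - y + 1 by ring,
      show x - 1 - y = x - y - 1 by ring, show x - (y + 1) = x - y - 1 by ring,
      show x - (y - 1) = x - y + 1 by ring]
    linear_combination E ^ x * E ^ y * h
      + I * E ^ x * E ^ y * (g (x - y + 1) - g (x - y - 1)) * hE

/-- The stationary value `0`, with the identity matrix as eigenfunction. -/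
lemma zero_mem_spectrum (hL : ∀ (ψ : HSMatrix) (x y : ℤ),
      L ψ (x, y) = I * (ψ (x + 1, y) + ψ (x - 1, y) - ψ (x, y + 1) - ψ (x, y - 1))
        - (G : ℂ) * ψ (x, y) + (G : ℂ) * (if x = y then ψ (x, x) else 0)) :
    (0 : ℂ) ∈ spectrum ℂ L := by
  refine mem_spectrum_of_bounded_eigenfunction hL (C := 1) (p₀ := (0, 0))
    (Ψ := fun p ↦ if p.1 = p.2 then 1 else 0) (fun p ↦ ?_) (by simp) fun x y ↦ ?_
  · split_ifs <;> simp
  · have h1 : (x + 1 = y) = (x = y - 1) := propext (by omega)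
    have h2 : (x - 1 = y) = (x = y + 1) := propext (by omega)
    simp only [h1, h2, if_true]
    ring

end GeneralizedEigenfunctions


/-- Full spectrum of the Lindbladian with local dephasing: for the operator
`(𝓛ψ)(x,y) = i(ψ(x+1,y) + ψ(x-1,y) - ψ(x,y+1) - ψ(x,y-1)) - Gψ(x,y) + G·δ_{xy}·ψ(x,x)`
on `ℓ²(ℤ×ℤ)` with `G > 0`, the spectrum is `(-G + i[-4,4]) ∪ J` where `J = [-G, 0]` for
`G ≤ 4` and `J = [-G + √(G²-16), 0]` otherwise. -/
theorem spectrum_lindblad_dephasing (G : ℝ) (hG : 0 < G)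
    (L : lp (fun _ : ℤ × ℤ => ℂ) 2 →L[ℂ] lp (fun _ : ℤ × ℤ => ℂ) 2)
    (hL : ∀ (ψ : lp (fun _ : ℤ × ℤ => ℂ) 2) (x y : ℤ),
      L ψ (x, y) = Complex.I * (ψ (x + 1, y) + ψ (x - 1, y) - ψ (x, y + 1) - ψ (x, y - 1))
        - (G : ℂ) * ψ (x, y) + (G : ℂ) * (if x = y then ψ (x, x) else 0)) :
    spectrum ℂ L =
      {z : ℂ | ∃ t : ℝ, -4 ≤ t ∧ t ≤ 4 ∧ z = -(G : ℂ) + Complex.I * (t : ℂ)} ∪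
      {z : ℂ | ∃ s : ℝ,
        (if G ≤ 4 then -G else -G + Real.sqrt (G ^ 2 - 16)) ≤ s ∧ s ≤ 0 ∧ z = (s : ℂ)} := by
  apply Set.Subset.antisymm
  · intro z hz
    by_contra hnot
    simp only [Set.mem_union, Set.mem_ofPred_eq, not_or, not_exists, not_and] at hnot
    obtain ⟨hline, hJ⟩ := hnot
    have hGC : (G : ℂ) ≠ 0 := by exact_mod_cast hG.ne'
    set P : HSMatrix →L[ℂ] HSMatrix :=
      (G : ℂ)⁻¹ • (L + (G : ℂ) • 1 - I • (hop + star hop)) with hPdef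
    have hP : ∀ ψ x y, P ψ (x, y) = if x = y then ψ (x, y) else 0 := by
      intro ψ x y
      have : P ψ (x, y) = (G : ℂ)⁻¹ * (L ψ (x, y) + G * ψ (x, y)
          - I * (hop ψ (x, y) + star hop ψ (x, y))) := rfl
      rw [this, hL, hop_apply, star_hop_apply]
      field_simp
      split_ifs with h
      · subst h; ring
      · ring
    refine hz ?_
    have hdecomp : algebraMap ℂ _ z - L =
        -(I • (hop + star hop) - (z + G) • (1 : HSMatrix →L[ℂ] HSMatrix) + (G : ℂ) • P) := by
      rw [hPdef, smul_inv_smul₀ hGC, Algebra.algebraMap_eq_smul_one, add_smul]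
      abel
    rw [spectrum.mem_resolventSet_iff, hdecomp, IsUnit.neg_iff]
    refine isUnit_hop_add_diagonal hP hG ?_ ?_
    · by_contra! h
      obtain ⟨hre, him⟩ := h
      simp only [add_re, ofReal_re, add_im, ofReal_im, add_zero] at hre him
      refine hline z.im (neg_le_of_abs_le him) (le_of_abs_le him) (Complex.ext ?_ ?_)
      · simp; linarith
      · simp
    · intro v hv0 hvG hv h
      refine hJ (v - G) ?_ (by linarith) ?_
      · split_ifs
        · linarith
        · have : √(G ^ 2 - 16) ≤ v := Real.sqrt_le_iff.2 ⟨hv0.le, hv⟩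
          linarith
      · push_cast
        rw [← h]; ring
  · rintro z (⟨t, h1, h2, rfl⟩ | ⟨s, h1, h2, rfl⟩)
    · exact line_subset_spectrum hL ⟨h1, h2⟩
    · obtain ⟨h0, hsq⟩ : 0 ≤ s + G ∧ G ^ 2 - 16 ≤ (s + G) ^ 2 := by
        split_ifs at h1 with h4
        · exact ⟨by linarith, by nlinarith [sq_nonneg (s + G)]⟩
        · have h := Real.sqrt_nonneg (G ^ 2 - 16)
          exact ⟨by linarith, (Real.sqrt_le_left (by linarith)).1 (by linarith)⟩
      rcases h0.eq_or_lt with h0 | h0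
      · have := line_subset_spectrum hL (t := 0) (by norm_num)
        rwa [ofReal_zero, mul_zero, add_zero, ← ofReal_neg, show -G = s by linarith] at this
      rcases h2.eq_or_lt with rfl | h2
      · exact zero_mem_spectrum hL
      · have := bound_state_mem_spectrum hL h0 (by linarith) hsq
        rwa [← ofReal_neg, ← ofReal_add, show -G + (s + G) = s by ring] at this
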